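/- Let 0 < p < 1, θ > 0, k ≥ 1 an integer, and x ≥ 0. Set y(x) := (1 - e^{-θx}) / (1 - p e^{-θx}). Then ∫_0^x θ p^k e^{-θt} (1 - e^{-θt})^{k-1} / (A(p,k) (1 - p e^{-θt})^k) dt = A(p·y(x), k) / A(p,k), where A(q,k) := Σ_{j=k}^∞ q^j / j for 0 ≤ q < 1. -/

import Mathlib

open Real MeasureTheory

/-- The tail of the logarithmic series, `A(q,k) = Σ_{j=k}^∞ q^j / j`. -/
noncomputable def Apk (q : ℝ) (k : ℕ) : ℝ := ∑' j : ℕ, q ^ (j + k) / ((j + k : ℕ) : ℝ)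

lemma hasDerivAt_Apk_succ (m : ℕ) {q : ℝ} (hq : |q| < 1) :
    HasDerivAt (fun z => Apk z (m + 1)) (q ^ m / (1 - q)) q := by
  obtain ⟨r, hqr, hr⟩ := exists_between hq
  have hr0 : 0 < r := (abs_nonneg q).trans_lt hqr
  have key := hasDerivAt_tsum_of_isPreconnected
    (g := fun (j : ℕ) (z : ℝ) => z ^ (j + (m + 1)) / ((j + (m + 1) : ℕ) : ℝ))
    (g' := fun (j : ℕ) (z : ℝ) => z ^ (j + m)) (u := fun j => r ^ (j + m))
    (t := Set.Ioo (-r) r) (y₀ := 0) (y := q)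
    ((summable_nat_add_iff m).2 (summable_geometric_of_lt_one hr0.le hr))
    isOpen_Ioo isPreconnected_Ioo
    (fun j z _ => by
      have hne : ((j + (m + 1) : ℕ) : ℝ) ≠ 0 := by positivity
      have h := (hasDerivAt_pow (j + (m + 1)) z).div_const ((j + (m + 1) : ℕ) : ℝ)
      rwa [mul_div_cancel_left₀ _ hne] at h)
    (fun j z hz => by
      rw [norm_pow, Real.norm_eq_abs]
      exact pow_le_pow_left₀ (abs_nonneg z) (abs_lt.2 hz).le _)
    ⟨by linarith, hr0⟩
    (by simp)
    (abs_lt.1 hqr)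
  have hsum : ∑' j : ℕ, q ^ (j + m) = q ^ m / (1 - q) := by
    simp_rw [pow_add]
    rw [tsum_mul_right, tsum_geometric_of_abs_lt_one hq, mul_comm, div_eq_mul_inv]
  rwa [hsum] at key

lemma Apk_zero_succ (m : ℕ) : Apk 0 (m + 1) = 0 := by
  simp [Apk]

/-- The cumulative distribution function of the EGTL distribution:
`G_k(x) = A(p·y(x), k) / A(p,k)` where `y(x) = (1 - e^{-θx})/(1 - p e^{-θx})`. -/
theorem egtl_cdf (p θ x : ℝ) (hp0 : 0 < p) (hp1 : p < 1) (hθ : 0 < θ) (hx : 0 ≤ x)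
    (k : ℕ) (hk : 1 ≤ k) :
    ∫ t in (0 : ℝ)..x,
        θ * p ^ k * Real.exp (-θ * t) * (1 - Real.exp (-θ * t)) ^ (k - 1) /
          (Apk p k * (1 - p * Real.exp (-θ * t)) ^ k)
      = Apk (p * ((1 - Real.exp (-θ * x)) / (1 - p * Real.exp (-θ * x)))) k / Apk p k := by
  obtain ⟨m, rfl⟩ := Nat.exists_eq_add_of_le' hk
  rw [Nat.add_sub_cancel]
  have hexp : ∀ t ∈ Set.uIcc 0 x, Real.exp (-θ * t) ≤ 1 := by
    intro t ht
    rw [Set.uIcc_of_le hx] at ht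
    exact Real.exp_le_one_iff.2 (by nlinarith [ht.1])
  have hden : ∀ t ∈ Set.uIcc 0 x, 0 < 1 - p * Real.exp (-θ * t) := fun t ht => by
    nlinarith [hexp t ht]
  have hderiv : ∀ t ∈ Set.uIcc 0 x, HasDerivAt
      (fun t => Apk (p * ((1 - Real.exp (-θ * t)) / (1 - p * Real.exp (-θ * t)))) (m + 1))
      (θ * p ^ (m + 1) * Real.exp (-θ * t) * (1 - Real.exp (-θ * t)) ^ m /
        (1 - p * Real.exp (-θ * t)) ^ (m + 1)) t := by
    intro t ht
    have hD := hden t ht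
    have hE := hexp t ht
    have hE0 := Real.exp_pos (-θ * t)
    have he : HasDerivAt (fun t => Real.exp (-θ * t)) (Real.exp (-θ * t) * (-θ)) t := by
      simpa using ((hasDerivAt_id t).const_mul (-θ)).exp
    have hy := (((he.const_sub 1).div ((he.const_mul p).const_sub 1) hD.ne').const_mul p)
    have hq : |p * ((1 - Real.exp (-θ * t)) / (1 - p * Real.exp (-θ * t)))| < 1 := by
      rw [abs_of_nonneg (mul_nonneg hp0.le (div_nonneg (by linarith) hD.le)), ← mul_div_assoc,
        div_lt_one hD]
      linarith
    refine ((hasDerivAt_Apk_succ m hq).comp t hy).congr_deriv ?_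
    generalize Real.exp (-θ * t) = e at *
    have h1 : 1 - p * ((1 - e) / (1 - p * e)) = (1 - p) / (1 - p * e) := by
      field_simp
      ring
    have hp : 1 - p ≠ 0 := by linarith
    rw [h1, mul_pow, div_pow]
    field_simp
    ring
  have hint : IntervalIntegrable (fun t => θ * p ^ (m + 1) * Real.exp (-θ * t) *
      (1 - Real.exp (-θ * t)) ^ m / (1 - p * Real.exp (-θ * t)) ^ (m + 1)) volume 0 x := by
    apply ContinuousOn.intervalIntegrable
    exact ContinuousOn.div (by fun_prop) (by fun_prop) fun t ht => (pow_pos (hden t ht) _).ne'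
  have hftc := intervalIntegral.integral_eq_sub_of_hasDerivAt hderiv hint
  simp only [mul_zero, Real.exp_zero, sub_self, zero_div, Apk_zero_succ, sub_zero] at hftc
  rw [← hftc, ← intervalIntegral.integral_div]
  simp_rw [div_div, mul_comm (Apk p (m + 1))]
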